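/- Let k be a field, w ≥ 1 a natural number, and let C be a k-linear Hom-finite triangulated category with shift functor Σ which is (−w)-Calabi–Yau, i.e. Σ^{-w} is a Serre functor of C: there are isomorphisms Hom_C(x, y) ≅ Hom_C(y, Σ^{-w}x)* (k-linear dual), natural in x and y. Then for every t-structure (X, Y) on C, the heart H = X ∩ ΣY is zero, i.e. every object of H is a zero object. -/

import Mathlib

/-!
Formalization of Lemma 5.1 (Holm–Jørgensen–Yang): in a `(-w)`-Calabi–Yau
triangulated category, the heart of any t-structure is zero.
-/

open CategoryTheory Category Limits Pretriangulated

universe v u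

/-- A class of objects closed under isomorphisms and under `Σ⁻¹` is closed under `Σ⁻ⁿ`. -/
theorem shift_neg_natCast_mem {C : Type u} [Category.{v} C] [HasShift C ℤ] {Y : Set C}
    (hYiso : ∀ ⦃x y : C⦄, (x ≅ y) → x ∈ Y → y ∈ Y)
    (hYshift : ∀ y ∈ Y, y⟦(-1 : ℤ)⟧ ∈ Y) {y : C} (hy : y ∈ Y) (n : ℕ) :
    y⟦-(n : ℤ)⟧ ∈ Y := by
  induction n with
  | zero => exact hYiso ((shiftFunctorZero' C (-((0 : ℕ) : ℤ)) (by simp)).app y).symm hy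
  | succ n ih =>
    exact hYiso ((shiftFunctorAdd' C (-(n : ℤ)) (-1) (-((n + 1 : ℕ) : ℤ))
      (by omega)).app y).symm (hYshift _ ih)

/-- Let `k` be a field, `w ≥ 1`, and `C` a `k`-linear Hom-finite
triangulated category which is `(-w)`-Calabi–Yau, i.e. `Σ^{-w}` is a Serre
functor: there are isomorphisms `Hom(x, y) ≅ Hom(y, Σ^{-w} x)*`, natural in both
variables.  Then for every t-structure `(X, Y)` on `C` the heart `H = X ∩ ΣY`
is zero. -/
theorem heart_of_tStructure_on_negCY_isZero
    (k : Type*) [Field k] {C : Type u} [Category.{v} C] [Preadditive C]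
    [CategoryTheory.Linear k C] [HasZeroObject C] [HasShift C ℤ]
    [∀ n : ℤ, (shiftFunctor C n).Additive] [Pretriangulated C] [IsTriangulated C]
    [∀ x y : C, FiniteDimensional k (x ⟶ y)]
    (w : ℕ) (hw : 1 ≤ w)
    -- Serre duality isomorphisms for the functor `Σ^{-w}`:
    (serre : ∀ x y : C, (x ⟶ y) ≃ₗ[k] Module.Dual k (y ⟶ x⟦-(w : ℤ)⟧))
    -- naturality in the first variable:
    (serre_nat₁ : ∀ ⦃x x' y : C⦄ (a : x' ⟶ x) (h : x ⟶ y) (u : y ⟶ x'⟦-(w : ℤ)⟧),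
      serre x' y (a ≫ h) u = serre x y h (u ≫ a⟦-(w : ℤ)⟧'))
    -- naturality in the second variable:
    (serre_nat₂ : ∀ ⦃x y y' : C⦄ (h : x ⟶ y) (b : y ⟶ y') (u : y' ⟶ x⟦-(w : ℤ)⟧),
      serre x y' (h ≫ b) u = serre x y h (b ≫ u))
    -- a t-structure `(X, Y)`:
    (X Y : Set C)
    (hXiso : ∀ ⦃x y : C⦄, (x ≅ y) → x ∈ X → y ∈ X)
    (hYiso : ∀ ⦃x y : C⦄, (x ≅ y) → x ∈ Y → y ∈ Y)
    (hXsummand : ∀ ⦃x z : C⦄ (i : x ⟶ z) (r : z ⟶ x), i ≫ r = 𝟙 x → z ∈ X → x ∈ X)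
    (hYsummand : ∀ ⦃x z : C⦄ (i : x ⟶ z) (r : z ⟶ x), i ≫ r = 𝟙 x → z ∈ Y → x ∈ Y)
    (hXshift : ∀ x ∈ X, x⟦(1 : ℤ)⟧ ∈ X)
    (hYshift : ∀ y ∈ Y, y⟦(-1 : ℤ)⟧ ∈ Y)
    (hHom : ∀ ⦃x y : C⦄, x ∈ X → y ∈ Y → ∀ f : x ⟶ y, f = 0)
    (hdec : ∀ c : C, ∃ (x y : C) (f : x ⟶ c) (g : c ⟶ y) (h : y ⟶ x⟦(1 : ℤ)⟧),
      x ∈ X ∧ y ∈ Y ∧ Triangle.mk f g h ∈ distTriang C) :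
    -- the heart `H = X ∩ ΣY` is zero:
    ∀ h : C, h ∈ X → h ∈ (fun y : C => y⟦(1 : ℤ)⟧) '' Y → IsZero h := by
  rintro _ hX ⟨y, hy, rfl⟩
  have hmem : (y⟦(1 : ℤ)⟧)⟦-(w : ℤ)⟧ ∈ Y :=
    hYiso ((shiftFunctorAdd' C (1 : ℤ) (-(w : ℤ)) (-((w - 1 : ℕ) : ℤ)) (by omega)).app y)
      (shift_neg_natCast_mem hYiso hYshift hy (w - 1))
  rw [IsZero.iff_id_eq_zero]
  apply (serre _ _).injective
  ext u
  rw [hHom hX hmem u, map_zero, map_zero]
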